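/- Let Δ′ ≥ 3 be an integer and let G be a finite connected simple graph with maximum degree Δ′ not isomorphic to K_{Δ′+1}. For i = 1, …, Δ′ define d_i = 1/(i+1) + (i−1)!·(1/e − Σ_{j=0}^{i+1} (−1)^j/j!) if i is even, and d_i = 1/(i+1) + (i−1)!·(Σ_{j=0}^{i+1} (−1)^j/j! − 1/e) if i is odd, where e is Euler's number. Then α(G) ≥ Σ_{i=1}^{Δ′} d_i·|V_i(G)|. -/

import Mathlib

/-- A set of vertices is independent if its elements are pairwise nonadjacent. -/
def IsIndepSet {V : Type*} (G : SimpleGraph V) (s : Set V) : Prop :=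
  s.Pairwise fun a b => ¬ G.Adj a b

/-- The independence number: the largest cardinality of an independent set of vertices. -/
noncomputable def indepNum {V : Type*} [Fintype V] (G : SimpleGraph V) : ℕ :=
  sSup {n | ∃ s : Finset V, IsIndepSet G ↑s ∧ s.card = n}

/-- The coefficients `d_i`. -/
noncomputable def dcoef (i : ℕ) : ℝ :=
  if Even i then
    1 / ((i : ℝ) + 1) + (Nat.factorial (i - 1) : ℝ) *
      (1 / Real.exp 1 - ∑ j ∈ Finset.range (i + 2), (-1 : ℝ) ^ j / (Nat.factorial j : ℝ))
  else
    1 / ((i : ℝ) + 1) + (Nat.factorial (i - 1) : ℝ) *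
      (∑ j ∈ Finset.range (i + 2), (-1 : ℝ) ^ j / (Nat.factorial j : ℝ) - 1 / Real.exp 1)

open Finset in
theorem abs_one_div_exp_one_sub_sum_le (i : ℕ) :
    |1 / Real.exp 1 - ∑ j ∈ range (i + 2), (-1 : ℝ) ^ j / (Nat.factorial j : ℝ)| ≤
      ((i : ℝ) + 3) / ((Nat.factorial (i + 2) : ℝ) * ((i : ℝ) + 2)) := by
  have h := Real.exp_bound (x := -1) (by simp) (n := i + 2) (by omega)
  rw [Real.exp_neg, ← one_div] at h
  refine h.trans (le_of_eq ?_)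
  push_cast
  simp only [abs_neg, abs_one, one_pow, one_mul]
  congr 1
  ring

theorem dcoef_nonneg {i : ℕ} (hi : 1 ≤ i) : 0 ≤ dcoef i := by
  obtain ⟨k, rfl⟩ : ∃ k, i = k + 1 := ⟨i - 1, by omega⟩
  have h := abs_one_div_exp_one_sub_sum_le (k + 1)
  have hf : (Nat.factorial k : ℝ) * (((k + 1 : ℕ) : ℝ) + 3) /
      ((Nat.factorial (k + 1 + 2) : ℝ) * (((k + 1 : ℕ) : ℝ) + 2)) ≤
      1 / (((k + 1 : ℕ) : ℝ) + 1) := by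
    have : (0 : ℝ) < Nat.factorial k := by positivity
    rw [div_le_div_iff₀ (by positivity) (by positivity)]
    simp only [Nat.factorial_succ]
    push_cast
    have hk : (0 : ℝ) ≤ k := by positivity
    have : ((k : ℝ) + 1 + 3) * (k + 1 + 1) ≤
        (k + 1 + 1 + 1) * ((k + 1 + 1) * (k + 1)) * (k + 1 + 2) := by
      nlinarith [mul_nonneg hk hk, mul_nonneg (mul_nonneg hk hk) hk,
        mul_nonneg (mul_nonneg (mul_nonneg hk hk) hk) hk]
    nlinarith
  have h1 := mul_le_mul_of_nonneg_left h (by positivity : (0 : ℝ) ≤ (Nat.factorial k : ℝ))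
  rw [← mul_div_assoc] at h1
  have h2 := h1.trans hf
  rw [← abs_of_nonneg (by positivity : (0 : ℝ) ≤ (Nat.factorial k : ℝ)), ← abs_mul,
    abs_le] at h2
  unfold dcoef
  rw [Nat.add_sub_cancel]
  split_ifs <;> linarith

theorem dcoef_succ_add {i : ℕ} (hi : 1 ≤ i) : dcoef (i + 1) + i * dcoef i = 1 := by
  obtain ⟨k, rfl⟩ : ∃ k, i = k + 1 := ⟨i - 1, by omega⟩
  have hfac : (Nat.factorial k : ℝ) ≠ 0 := by positivity
  have hk : (k : ℝ) + 1 ≠ 0 := by positivity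
  have hk2 : (k : ℝ) + 1 + 1 ≠ 0 := by positivity
  have hk3 : (k : ℝ) + 1 + 1 + 1 ≠ 0 := by positivity
  have key : ((k : ℝ) + 1 + 1) * (1 / (k + 1 + 1) - 1 / (k + 1 + 1 + 1)) = 1 / (k + 1 + 1 + 1) := by
    field_simp; ring
  have key2 : ((Nat.factorial k : ℝ) * (k + 1)) * (1 / (Nat.factorial (k + 3) : ℝ)) =
      1 / (k + 1 + 1) - 1 / (k + 1 + 1 + 1) := by
    simp only [Nat.factorial_succ]
    push_cast
    field_simp
    ring
  have key3 : ((k : ℝ) + 1) * (1 / (k + 1 + 1)) = 1 - 1 / (k + 1 + 1) := by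
    field_simp; ring
  unfold dcoef
  rw [show k + 1 + 1 + 2 = (k + 1 + 2) + 1 from rfl, Finset.sum_range_succ]
  rw [show k + 1 + 1 - 1 = k + 1 from rfl, show k + 1 - 1 = k from rfl,
    show k + 1 + 2 = k + 3 from rfl]
  generalize ∑ j ∈ Finset.range (k + 3), (-1 : ℝ) ^ j / (Nat.factorial j : ℝ) = s
  generalize 1 / Real.exp 1 = e
  have hfs : (Nat.factorial (k + 1) : ℝ) = (Nat.factorial k : ℝ) * (k + 1) := by
    rw [Nat.factorial_succ]; push_cast; ring
  rw [hfs]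
  push_cast
  rcases Nat.even_or_odd k with hev | hod
  · have h1 : ¬ Even (k + 1) := by simpa [Nat.even_add_one] using hev
    have h2 : Even (k + 1 + 1) := by simpa [Nat.even_add_one] using hev
    have h3 : (-1 : ℝ) ^ (k + 3) = -1 := Odd.neg_one_pow (by grind)
    rw [if_pos h2, if_neg h1, h3, neg_div]
    linear_combination key2 + key3
  · have h1 : Even (k + 1) := by grind
    have h2 : ¬ Even (k + 1 + 1) := by grind
    have h3 : (-1 : ℝ) ^ (k + 3) = 1 := Even.neg_one_pow (by grind)
    rw [if_neg h2, if_pos h1, h3]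
    linear_combination key2 + key3

theorem mul_dcoef_le_one {i : ℕ} (hi : 1 ≤ i) : i * dcoef i ≤ 1 := by
  linarith [dcoef_succ_add hi, dcoef_nonneg (i := i + 1) (by omega)]

theorem one_le_succ_mul_dcoef {i : ℕ} (hi : 1 ≤ i) : 1 ≤ ((i : ℝ) + 1) * dcoef i := by
  have h := mul_dcoef_le_one (i := i + 1) (by omega)
  have hr := dcoef_succ_add hi
  push_cast at h
  have hi' : (1 : ℝ) ≤ i := by exact_mod_cast hi
  have : (i : ℝ) * 1 ≤ i * ((i + 1) * dcoef i) := by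
    rw [eq_sub_of_add_eq hr] at h
    linarith
  exact le_of_mul_le_mul_left this (by linarith)

theorem two_mul_add_one_mul_dcoef_le {i : ℕ} (hi : 1 ≤ i) :
    (2 * (i : ℝ) + 1) * dcoef i ≤ 2 := by
  have h := one_le_succ_mul_dcoef (i := i + 1) (by omega)
  have hr := dcoef_succ_add hi
  push_cast at h
  have hi' : (1 : ℝ) ≤ i := by exact_mod_cast hi
  rw [eq_sub_of_add_eq hr] at h
  have h2 : (i : ℝ) * (i + 2) * dcoef i ≤ i + 1 := by linarith
  have h3 : (i : ℝ) * (i + 2) * ((2 * (i : ℝ) + 1) * dcoef i) ≤ i * (i + 2) * 2 := by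
    nlinarith
  exact le_of_mul_le_mul_left h3 (by nlinarith)

theorem dcoef_antitone : Antitone dcoef := by
  refine antitone_nat_of_succ_le fun i => ?_
  rcases Nat.eq_zero_or_pos i with rfl | hi
  · have : 0 < Real.exp 1 := Real.exp_pos 1
    have : 0 < (Real.exp 1)⁻¹ := by positivity
    simp [dcoef, Finset.sum_range_succ]
    linarith
  · linarith [dcoef_succ_add hi, one_le_succ_mul_dcoef hi]

section IndependentSets

open Finset

variable {V : Type*} (G : SimpleGraph V)

open Classical in
/-- The neighbours of `v` lying in `B`. -/
noncomputable def nbrsIn (B : Finset V) (v : V) : Finset V := B.filter (G.Adj v)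

/-- `C` is the vertex set of a complete component of the subgraph induced by `B`. -/
def IsCompleteComponent (B C : Finset V) : Prop :=
  C ⊆ B ∧ C.Nonempty ∧ (∀ a ∈ C, ∀ b ∈ C, a ≠ b → G.Adj a b) ∧
    ∀ a ∈ C, ∀ b ∈ B, G.Adj a b → b ∈ C

variable {G}

@[simp]
theorem mem_nbrsIn {B : Finset V} {v u : V} : u ∈ nbrsIn G B v ↔ u ∈ B ∧ G.Adj v u := by
  simp [nbrsIn]

open Classical in
theorem sum_dcoef_le_one_of_exit {B C : Finset V} (hCB : C ⊆ B)
    (hC : ∀ a ∈ C, ∀ b ∈ C, a ≠ b → G.Adj a b)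
    {a b : V} (ha : a ∈ C) (hb : b ∈ B) (hbC : b ∉ C) (hab : G.Adj a b) :
    ∑ v ∈ C, dcoef (#(nbrsIn G B v)) ≤ 1 := by
  have hle : ∀ v ∈ C, #C - 1 ≤ #(nbrsIn G B v) := fun v hv => by
    rw [← card_erase_of_mem hv]
    refine card_le_card fun u hu => ?_
    rw [mem_erase] at hu
    exact mem_nbrsIn.2 ⟨hCB hu.2, hC v hv u hu.2 (Ne.symm hu.1)⟩
  have hlea : #C ≤ #(nbrsIn G B a) := by
    have : insert b (C.erase a) ⊆ nbrsIn G B a := fun u hu => by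
      rw [mem_insert, mem_erase] at hu
      rcases hu with rfl | hu
      · exact mem_nbrsIn.2 ⟨hb, hab⟩
      · exact mem_nbrsIn.2 ⟨hCB hu.2, hC a ha u hu.2 (Ne.symm hu.1)⟩
    have h := card_le_card this
    rw [card_insert_of_notMem (by simp [hbC]), card_erase_of_mem ha] at h
    have := card_pos.2 ⟨a, ha⟩
    omega
  rw [← add_sum_erase _ _ ha]
  have h1 : ∑ v ∈ C.erase a, dcoef (#(nbrsIn G B v)) ≤ ((#C - 1 : ℕ) : ℝ) * dcoef (#C - 1) := by
    rw [← card_erase_of_mem ha, ← nsmul_eq_mul]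
    refine sum_le_card_nsmul _ _ _ fun v hv => ?_
    rw [card_erase_of_mem ha]
    exact dcoef_antitone (hle v (mem_of_mem_erase hv))
  have h2 := dcoef_antitone hlea
  obtain ⟨k, hk⟩ : ∃ k, #C = k + 1 := ⟨#C - 1, by have := card_pos.2 ⟨a, ha⟩; omega⟩
  rw [hk, Nat.add_sub_cancel] at h1
  rw [hk] at h2
  rcases Nat.eq_zero_or_pos k with rfl | hk0
  · have := mul_dcoef_le_one (i := 1) le_rfl
    norm_num at *
    linarith
  · linarith [dcoef_succ_add hk0]

open Classical in
theorem exists_indepSet_closed_nbhd_sum_le {B : Finset V} (hB : B.Nonempty)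
    (hno : ∀ C, ¬ IsCompleteComponent G B C) :
    ∃ S ⊆ B, S.Nonempty ∧ IsIndepSet G (S : Set V) ∧
      ∑ v ∈ S.biUnion (fun s => insert s (nbrsIn G B s)), dcoef (#(nbrsIn G B v)) ≤ #S := by
  obtain ⟨v, hv, hmin⟩ := exists_min_image B (fun v => #(nbrsIn G B v)) hB
  set δ := #(nbrsIn G B v) with hδ
  have hvn : ∀ w, w ∉ nbrsIn G B w := fun w h => G.loopless.irrefl w (mem_nbrsIn.1 h).2
  have hδ1 : 1 ≤ δ := by
    by_contra h0
    have h0 : nbrsIn G B v = ∅ := card_eq_zero.1 (by omega)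
    refine hno {v} ⟨by simpa using hv, by simp, by simp +contextual, ?_⟩
    intro a ha b hb hab
    rw [mem_singleton] at ha
    subst ha
    exact absurd (mem_nbrsIn.2 ⟨hb, hab⟩) (by simp [h0])
  by_cases hex : ∃ u ∈ nbrsIn G B v, δ < #(nbrsIn G B u)
  · obtain ⟨u, hu, hlt⟩ := hex
    refine ⟨{v}, by simpa using hv, by simp, by simp [IsIndepSet], ?_⟩
    rw [singleton_biUnion, ← add_sum_erase _ _ (mem_insert_of_mem hu)]
    have hcard : #((insert v (nbrsIn G B v)).erase u) = δ := by
      rw [card_erase_of_mem (mem_insert_of_mem hu), card_insert_of_notMem (hvn v)]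
      omega
    have h1 : ∑ w ∈ (insert v (nbrsIn G B v)).erase u, dcoef (#(nbrsIn G B w)) ≤
        (δ : ℝ) * dcoef δ := by
      rw [← nsmul_eq_mul, ← hcard]
      refine sum_le_card_nsmul _ _ _ fun w hw => ?_
      rw [hcard]
      refine dcoef_antitone (hmin w ?_)
      rcases mem_insert.1 (mem_of_mem_erase hw) with rfl | h
      exacts [hv, (mem_nbrsIn.1 h).1]
    have h2 := dcoef_antitone (Nat.succ_le_of_lt hlt)
    have h3 := dcoef_succ_add hδ1
    simp only [card_singleton, Nat.cast_one]
    simp only [Nat.succ_eq_add_one] at h2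
    linarith
  · push Not at hex
    have hnon : ∃ a ∈ nbrsIn G B v, ∃ b ∈ nbrsIn G B v, a ≠ b ∧ ¬ G.Adj a b := by
      by_contra! hcl
      have hclique : ∀ a ∈ insert v (nbrsIn G B v), ∀ b ∈ insert v (nbrsIn G B v),
          a ≠ b → G.Adj a b := by
        intro a ha b hb hab
        rcases mem_insert.1 ha with rfl | ha' <;> rcases mem_insert.1 hb with rfl | hb'
        · exact absurd rfl hab
        · exact (mem_nbrsIn.1 hb').2
        · exact (mem_nbrsIn.1 ha').2.symm
        · exact hcl a ha' b hb' hab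
      refine hno (insert v (nbrsIn G B v)) ⟨?_, by simp, hclique, ?_⟩
      · exact insert_subset hv (filter_subset _ _)
      · intro a ha b hb hab
        have hsub : (insert v (nbrsIn G B v)).erase a ⊆ nbrsIn G B a := fun u hu => by
          rw [mem_erase] at hu
          refine mem_nbrsIn.2 ⟨?_, hclique a ha u hu.2 (Ne.symm hu.1)⟩
          rcases mem_insert.1 hu.2 with rfl | h
          exacts [hv, (mem_nbrsIn.1 h).1]
        have hdeg : #(nbrsIn G B a) ≤ δ := by
          rcases mem_insert.1 ha with rfl | h
          exacts [le_rfl, hex a h]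
        have heq := eq_of_subset_of_card_le hsub (by
          rw [card_erase_of_mem ha, card_insert_of_notMem (hvn v)]
          omega)
        exact mem_of_mem_erase (heq ▸ mem_nbrsIn.2 ⟨hb, hab⟩ :
          b ∈ (insert v (nbrsIn G B v)).erase a)
    obtain ⟨a, ha, b, hb, hab, hnadj⟩ := hnon
    obtain ⟨haB, hva⟩ := mem_nbrsIn.1 ha
    obtain ⟨hbB, hvb⟩ := mem_nbrsIn.1 hb
    have hsubB : insert a (nbrsIn G B a) ∪ insert b (nbrsIn G B b) ⊆ B :=
      union_subset (insert_subset haB (filter_subset _ _))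
        (insert_subset hbB (filter_subset _ _))
    refine ⟨{a, b}, by simp [insert_subset_iff, haB, hbB], by simp, ?_, ?_⟩
    · rw [IsIndepSet, coe_pair, Set.pairwise_pair]
      exact fun _ => ⟨hnadj, fun h => hnadj h.symm⟩
    · rw [biUnion_insert, singleton_biUnion, card_pair hab]
      have hcard : #(insert a (nbrsIn G B a) ∪ insert b (nbrsIn G B b)) ≤ 2 * δ + 1 := by
        have h := card_union_add_card_inter (insert a (nbrsIn G B a)) (insert b (nbrsIn G B b))
        rw [card_insert_of_notMem (hvn a), card_insert_of_notMem (hvn b)] at h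
        have hpos : 0 < #(insert a (nbrsIn G B a) ∩ insert b (nbrsIn G B b)) := by
          refine card_pos.2 ⟨v, mem_inter.2 ⟨?_, ?_⟩⟩
          · exact mem_insert_of_mem (mem_nbrsIn.2 ⟨hv, hva.symm⟩)
          · exact mem_insert_of_mem (mem_nbrsIn.2 ⟨hv, hvb.symm⟩)
        have := hex a ha
        have := hex b hb
        omega
      refine (sum_le_card_nsmul _ _ (dcoef δ) fun w hw =>
        dcoef_antitone (hmin w (hsubB hw))).trans ?_
      rw [nsmul_eq_mul]
      refine le_trans ?_ (two_mul_add_one_mul_dcoef_le hδ1)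
      exact mul_le_mul_of_nonneg_right (by exact_mod_cast hcard) (dcoef_nonneg hδ1)

open Classical in
theorem exists_indepSet_sum_le (w : V → ℝ) (B : Finset V)
    (hw : ∀ v ∈ B, w v ≤ dcoef (#(nbrsIn G B v)))
    (hcomp : ∀ C, IsCompleteComponent G B C → ∑ v ∈ C, w v ≤ 1) :
    ∃ S ⊆ B, IsIndepSet G (S : Set V) ∧ ∑ v ∈ B, w v ≤ #S := by
  induction hn : #B using Nat.strong_induction_on generalizing B with
  | _ n ih =>
    have extend : ∀ S R : Finset V, S ⊆ R → R ⊆ B → R.Nonempty → IsIndepSet G (S : Set V) →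
        (∀ s ∈ S, ∀ u ∈ B \ R, ¬ G.Adj s u) → ∑ v ∈ R, w v ≤ #S →
        (∀ C, IsCompleteComponent G (B \ R) C → ∑ v ∈ C, w v ≤ 1) →
        ∃ S ⊆ B, IsIndepSet G (S : Set V) ∧ ∑ v ∈ B, w v ≤ #S := by
      intro S R hSR hRB hR hS hsep hsum hC
      have hlt : #(B \ R) < n := by
        rw [← hn]
        exact card_lt_card (sdiff_ssubset hRB hR)
      obtain ⟨T, hTB, hT, hTsum⟩ := ih _ hlt (B \ R) (fun v hv =>
        (hw v (mem_sdiff.1 hv).1).trans (dcoef_antitone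
          (card_le_card (filter_subset_filter _ sdiff_subset)))) hC rfl
      refine ⟨S ∪ T, union_subset (hSR.trans hRB) (hTB.trans sdiff_subset), ?_, ?_⟩
      · intro x hx y hy hxy
        rw [coe_union] at hx hy
        rcases hx with hx | hx <;> rcases hy with hy | hy
        · exact hS hx hy hxy
        · exact hsep x hx y (hTB hy)
        · exact fun h => hsep y hy x (hTB hx) h.symm
        · exact hT hx hy hxy
      · rw [card_union_of_disjoint (disjoint_of_subset_left hSR
          (disjoint_of_subset_right hTB disjoint_sdiff)), ← sum_sdiff hRB]
        push_cast
        linarith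
    rcases B.eq_empty_or_nonempty with rfl | hB
    · exact ⟨∅, by simp, by simp [IsIndepSet], by simp⟩
    by_cases hex : ∃ C, IsCompleteComponent G B C
    · obtain ⟨C, hC⟩ := hex
      obtain ⟨hCB, ⟨c, hc⟩, -, hcl⟩ := id hC
      refine extend {c} C (by simpa using hc) hCB ⟨c, hc⟩ (by simp [IsIndepSet]) ?_ ?_ ?_
      · intro s hs u hu hadj
        rw [mem_singleton] at hs
        subst hs
        exact (mem_sdiff.1 hu).2 (hcl s hc u (mem_sdiff.1 hu).1 hadj)
      · simpa using hcomp C hC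
      · rintro D ⟨hDB, hD, hDadj, hDcl⟩
        refine hcomp D ⟨hDB.trans sdiff_subset, hD, hDadj, fun a ha b hb hab => ?_⟩
        refine hDcl a ha b (mem_sdiff.2 ⟨hb, fun hbC => ?_⟩) hab
        have haB := mem_sdiff.1 (hDB ha)
        exact haB.2 (hcl b hbC a haB.1 hab.symm)
    · push Not at hex
      obtain ⟨S, hSB, ⟨s₀, hs₀⟩, hS, hsum⟩ := exists_indepSet_closed_nbhd_sum_le hB hex
      have hRB : S.biUnion (fun s => insert s (nbrsIn G B s)) ⊆ B :=
        biUnion_subset.2 fun s hs => insert_subset (hSB hs) (filter_subset _ _)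
      have hSR : S ⊆ S.biUnion (fun s => insert s (nbrsIn G B s)) := fun s hs =>
        mem_biUnion.2 ⟨s, hs, mem_insert_self _ _⟩
      refine extend S _ hSR hRB ⟨s₀, hSR hs₀⟩ hS ?_
        ((sum_le_sum fun v hv => hw v (hRB hv)).trans hsum) ?_
      · intro s hs u hu hadj
        rw [mem_sdiff] at hu
        exact hu.2 (mem_biUnion.2 ⟨s, hs, mem_insert_of_mem (mem_nbrsIn.2 ⟨hu.1, hadj⟩)⟩)
      · rintro D ⟨hDB, hD, hDadj, -⟩
        have hDB' := hDB.trans sdiff_subset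
        have hout : ∃ a ∈ D, ∃ b ∈ B, G.Adj a b ∧ b ∉ D := by
          by_contra! hcl
          exact hex D ⟨hDB', hD, hDadj, hcl⟩
        obtain ⟨a, ha, b, hb, hab, hbD⟩ := hout
        exact (sum_le_sum fun v hv => hw v (hDB' hv)).trans
          (sum_dcoef_le_one_of_exit hDB' hDadj ha hb hbD hab)

end IndependentSets

theorem SimpleGraph.Connected.mem_of_adj_closed {V : Type*} {G : SimpleGraph V}
    (hconn : G.Connected) {C : Set V} {c : V} (hc : c ∈ C)
    (hcl : ∀ a ∈ C, ∀ b, G.Adj a b → b ∈ C) (v : V) : v ∈ C := by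
  obtain ⟨p⟩ := hconn.preconnected c v
  induction p with
  | nil => exact hc
  | cons h _ ih => exact ih (hcl _ hc _ h)

theorem card_le_indepNum {V : Type*} [Fintype V] {G : SimpleGraph V} {S : Finset V}
    (hS : IsIndepSet G (S : Set V)) : S.card ≤ indepNum G := by
  refine le_csSup ⟨Fintype.card V, ?_⟩ ⟨S, hS, rfl⟩
  rintro n ⟨T, -, rfl⟩
  exact T.card_le_univ

theorem stmt6 (Δ' : ℕ) (hΔ' : 3 ≤ Δ') {V : Type*} [Fintype V]
    (G : SimpleGraph V) [DecidableRel G.Adj]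
    (hconn : G.Connected) (hmax : G.maxDegree = Δ')
    (hnotK : ¬ Nonempty (G ≃g (⊤ : SimpleGraph (Fin (Δ' + 1))))) :
    ∑ i ∈ Finset.Icc 1 Δ',
      dcoef i * ((Finset.univ.filter fun v : V => G.degree v = i).card : ℝ)
      ≤ (indepNum G : ℝ) := by
  classical
  have hdeg : ∀ v, (nbrsIn G Finset.univ v).card = G.degree v := fun v => by
    rw [← G.card_neighborFinset_eq_degree]
    congr 1
    ext u
    simp
  have hnone : ∀ C, ¬ IsCompleteComponent G Finset.univ C := by
    rintro C ⟨-, ⟨c, hc⟩, hadj, hcl⟩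
    have hall : ∀ v, v ∈ C :=
      hconn.mem_of_adj_closed (C := (C : Set V)) hc fun a ha b hab => hcl a ha b (by simp) hab
    have htop : G = ⊤ := by
      ext a b
      exact ⟨fun h => h.ne, fun h => hadj a (hall a) b (hall b) h⟩
    have : Nonempty V := ⟨c⟩
    obtain ⟨v, hv⟩ := G.exists_maximal_degree_vertex
    have hcard : Fintype.card V = Δ' + 1 := by
      have h1 : G.degree v = Fintype.card V - 1 := by
        subst htop
        convert SimpleGraph.complete_graph_degree v
      have := Fintype.card_pos (α := V)
      omega
    refine hnotK ⟨?_⟩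
    rw [htop]
    exact SimpleGraph.Iso.completeGraph (Fintype.equivFinOfCardEq hcard)
  obtain ⟨S, -, hS, hsum⟩ := exists_indepSet_sum_le (G := G)
    (fun v => dcoef (G.degree v)) Finset.univ (fun v _ => by rw [hdeg])
    (fun C hC => absurd hC (hnone C))
  calc ∑ i ∈ Finset.Icc 1 Δ',
      dcoef i * ((Finset.univ.filter fun v : V => G.degree v = i).card : ℝ)
      = ∑ i ∈ Finset.Icc 1 Δ', ∑ v with G.degree v = i, dcoef (G.degree v) := by
        refine Finset.sum_congr rfl fun i _ => ?_
        rw [Finset.sum_congr rfl fun v hv => by rw [(Finset.mem_filter.1 hv).2],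
          Finset.sum_const, nsmul_eq_mul, mul_comm]
    _ = ∑ v with G.degree v ∈ Finset.Icc 1 Δ', dcoef (G.degree v) := by
        rw [← Finset.sum_fiberwise_of_maps_to (s := Finset.univ.filter fun v =>
          G.degree v ∈ Finset.Icc 1 Δ') (t := Finset.Icc 1 Δ') (g := fun v => G.degree v)
          (fun v hv => (Finset.mem_filter.1 hv).2)]
        refine Finset.sum_congr rfl fun i hi => Finset.sum_congr ?_ fun _ _ => rfl
        ext v
        simp only [Finset.mem_filter, Finset.mem_univ, true_and]
        exact ⟨fun h => ⟨h ▸ hi, h⟩, fun h => h.2⟩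
    _ ≤ ∑ v, dcoef (G.degree v) := by
        refine Finset.sum_le_sum_of_subset_of_nonneg (Finset.filter_subset _ _) fun v _ _ => ?_
        exact (dcoef_nonneg (Nat.succ_pos _)).trans (dcoef_antitone (Nat.le_succ _))
    _ ≤ S.card := hsum
    _ ≤ indepNum G := by exact_mod_cast card_le_indepNum hS
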